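/- Fix n, N ≥ 1 and constants Γ > 0, σ > 0, an n×n real matrix K, and constant vectors W*₁, …, W*_n ∈ ℝ^N. Let M : [0,∞) → ℝ^{n×n} be differentiable with M(t) symmetric for every t, let C : [0,∞) → ℝ^{n×n} be continuous with M′(t) − 2C(t) skew-symmetric for every t, and let r : [0,∞) → ℝⁿ, W̃₁, …, W̃_n : [0,∞) → ℝ^N be differentiable and S₁, …, S_n : [0,∞) → ℝ^N, ε : [0,∞) → ℝⁿ continuous, satisfying for all t ≥ 0: M(t) r′(t) = u(t) − ε(t) − K r(t) − C(t) r(t), where u(t) ∈ ℝⁿ has j-th component u_j(t) = ⟨W̃_j(t), S_j(t)⟩; and W̃_j′(t) = −Γ·(S_j(t)·r_j(t) + σ·(W̃_j(t) + W*_j)) for each j. Then the Lyapunov function V(t) = ½ r(t)ᵀ M(t) r(t) + (1/(2Γ))·Σ_{j=1}^n ‖W̃_j(t)‖² satisfies V′(t) = −r(t)ᵀ K r(t) − r(t)ᵀ ε(t) − σ·Σ_{j=1}^n ⟨W̃_j(t) + W*_j, W̃_j(t)⟩ for all t ≥ 0. -/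

import Mathlib

open scoped Matrix

theorem HasDerivAt.dotProduct_of_coord {ι : Type*} [Fintype ι] {u v : ℝ → ι → ℝ} {u' v' : ι → ℝ}
    {t : ℝ} (hu : ∀ i, HasDerivAt (fun s => u s i) (u' i) t)
    (hv : ∀ i, HasDerivAt (fun s => v s i) (v' i) t) :
    HasDerivAt (fun s => u s ⬝ᵥ v s) (u' ⬝ᵥ v t + u t ⬝ᵥ v') t := by
  simp only [dotProduct, ← Finset.sum_add_distrib]
  exact HasDerivAt.fun_sum fun i _ => (hu i).mul (hv i)

theorem Matrix.dotProduct_mulVec_self_of_transpose_eq_neg {ι : Type*} [Fintype ι]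
    {A : Matrix ι ι ℝ} (hA : Aᵀ = -A) (x : ι → ℝ) : x ⬝ᵥ A.mulVec x = 0 := by
  have h : x ⬝ᵥ A.mulVec x = -(x ⬝ᵥ A.mulVec x) := by
    conv_lhs => rw [Matrix.dotProduct_mulVec, ← Matrix.mulVec_transpose, hA, Matrix.neg_mulVec,
      neg_dotProduct, dotProduct_comm]
  linarith

/-- Central Lyapunov-derivative identity in the proof of Theorem 2: with the filtered-error
dynamics `M ṙ = W̃ᵀS - ε - K r - C r`, the robust adaptation law
`W̃ⱼ' = -Γ (Sⱼ rⱼ + σ (W̃ⱼ + W*ⱼ))`, `M` symmetric and `Ṁ - 2C` skew-symmetric, the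
Lyapunov function `V = ½ rᵀ M r + (1/(2Γ)) ∑ⱼ ‖W̃ⱼ‖²` satisfies
`V' = -rᵀ K r - rᵀ ε - σ ∑ⱼ ⟨W̃ⱼ + W*ⱼ, W̃ⱼ⟩`. -/
theorem lyapunov_derivative_identity
    (n N : ℕ) (hn : 1 ≤ n) (hN : 1 ≤ N)
    (Γ σ : ℝ) (hΓ : 0 < Γ) (hσ : 0 < σ)
    (K : Matrix (Fin n) (Fin n) ℝ) (Wstar : Fin n → Fin N → ℝ)
    (M M' C : ℝ → Matrix (Fin n) (Fin n) ℝ)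
    (r r' : ℝ → Fin n → ℝ)
    (Wt Wt' : Fin n → ℝ → Fin N → ℝ)
    (S : Fin n → ℝ → Fin N → ℝ) (ε : ℝ → Fin n → ℝ)
    (hM : ∀ t : ℝ, 0 ≤ t → ∀ i j, HasDerivAt (fun s => M s i j) (M' t i j) t)
    (hMsymm : ∀ t : ℝ, 0 ≤ t → (M t).IsSymm)
    (hCcont : ∀ i j, ContinuousOn (fun t => C t i j) (Set.Ici 0))
    (hskew : ∀ t : ℝ, 0 ≤ t → (M' t - 2 • C t)ᵀ = -(M' t - 2 • C t))
    (hr : ∀ t : ℝ, 0 ≤ t → ∀ i, HasDerivAt (fun s => r s i) (r' t i) t)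
    (hWt : ∀ j, ∀ t : ℝ, 0 ≤ t → ∀ p, HasDerivAt (fun s => Wt j s p) (Wt' j t p) t)
    (hScont : ∀ j p, ContinuousOn (fun t => S j t p) (Set.Ici 0))
    (hεcont : ∀ i, ContinuousOn (fun t => ε t i) (Set.Ici 0))
    (hdyn : ∀ t : ℝ, 0 ≤ t →
      (M t).mulVec (r' t) =
        (fun j => Wt j t ⬝ᵥ S j t) - ε t - K.mulVec (r t) - (C t).mulVec (r t))
    (hadapt : ∀ t : ℝ, 0 ≤ t → ∀ j,
      Wt' j t = -(Γ • (r t j • S j t + σ • (Wt j t + Wstar j)))) :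
    ∀ t : ℝ, 0 ≤ t →
      HasDerivAt
        (fun s => (1 / 2) * (r s ⬝ᵥ (M s).mulVec (r s))
          + (1 / (2 * Γ)) * ∑ j, (Wt j s ⬝ᵥ Wt j s))
        (-(r t ⬝ᵥ K.mulVec (r t)) - (r t ⬝ᵥ ε t)
          - σ * ∑ j, ((Wt j t + Wstar j) ⬝ᵥ Wt j t)) t := by
  intro t ht
  have hMr : ∀ i, HasDerivAt (fun s => (M s).mulVec (r s) i)
      (((M' t).mulVec (r t) + (M t).mulVec (r' t)) i) t := fun i =>
    HasDerivAt.dotProduct_of_coord (hM t ht i) (hr t ht)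
  have hV := ((HasDerivAt.dotProduct_of_coord (hr t ht) hMr).const_mul (1 / 2)).add
    ((HasDerivAt.fun_sum (u := Finset.univ) fun j _ =>
      HasDerivAt.dotProduct_of_coord (hWt j t ht) (hWt j t ht)).const_mul (1 / (2 * Γ)))
  refine hV.congr_deriv ?_
  have hsymm : r' t ⬝ᵥ (M t).mulVec (r t) = r t ⬝ᵥ (M t).mulVec (r' t) := by
    rw [Matrix.dotProduct_mulVec, ← Matrix.mulVec_transpose, (hMsymm t ht).eq, dotProduct_comm]
  have hMC : r t ⬝ᵥ (M' t).mulVec (r t) = 2 * (r t ⬝ᵥ (C t).mulVec (r t)) := by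
    have h := Matrix.dotProduct_mulVec_self_of_transpose_eq_neg (hskew t ht) (r t)
    simp only [two_smul, Matrix.sub_mulVec, Matrix.add_mulVec, dotProduct_sub,
      dotProduct_add] at h
    linarith
  have hW : (1 / (2 * Γ)) * ∑ j, (Wt' j t ⬝ᵥ Wt j t + Wt j t ⬝ᵥ Wt' j t) =
      -(r t ⬝ᵥ fun j => Wt j t ⬝ᵥ S j t) - σ * ∑ j, ((Wt j t + Wstar j) ⬝ᵥ Wt j t) := by
    rw [dotProduct, Finset.mul_sum, Finset.mul_sum, ← Finset.sum_neg_distrib,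
      ← Finset.sum_sub_distrib]
    refine Finset.sum_congr rfl fun j _ => ?_
    rw [dotProduct_comm (Wt j t) (Wt' j t), hadapt t ht j, neg_dotProduct, smul_dotProduct,
      add_dotProduct, smul_dotProduct, smul_dotProduct, dotProduct_comm (S j t)]
    simp only [smul_eq_mul]
    field_simp
    ring
  rw [hW, dotProduct_add, hsymm, hMC, hdyn t ht]
  simp only [dotProduct_sub]
  ring
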